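/- Let ν ≥ 0 be a real number and define Ber_ν(t) = ∑_{n=0}^∞ cos((3ν+2n)π/4) · f_{n,ν}(t) and Bei_ν(t) = ∑_{n=0}^∞ sin((3ν+2n)π/4) · f_{n,ν}(t) for t > 0. Then for all t > 0, (L_ν Bei_ν)(t) = Ber_ν(t). Together with L_ν Ber_ν = −Bei_ν, this shows Ber_ν and Bei_ν satisfy under L_ν exactly the relations that cos and sin satisfy under differentiation. -/

import Mathlib

open Real

/-- The monomial `f_{n,ν}(t) = (t/2)^(2n+ν) / (Γ(ν+n+1)·n!)`. -/
noncomputable def besselMonomial (ν : ℝ) (n : ℕ) (t : ℝ) : ℝ :=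
  (t / 2) ^ (2 * (n : ℝ) + ν) / (Real.Gamma (ν + n + 1) * n.factorial)

/-- The Bessel operator `L_ν f (t) = f''(t) + f'(t)/t − (ν²/t²) f(t)`. -/
noncomputable def besselOp (ν : ℝ) (f : ℝ → ℝ) (t : ℝ) : ℝ :=
  deriv (deriv f) t + deriv f t / t - (ν ^ 2 / t ^ 2) * f t

/-- Kelvin function `Ber_ν(t) = ∑ cos((3ν+2n)π/4) f_{n,ν}(t)`. -/
noncomputable def kelvinBer (ν : ℝ) (t : ℝ) : ℝ :=
  ∑' n : ℕ, Real.cos ((3 * ν + 2 * n) * π / 4) * besselMonomial ν n t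

/-- Kelvin function `Bei_ν(t) = ∑ sin((3ν+2n)π/4) f_{n,ν}(t)`. -/
noncomputable def kelvinBei (ν : ℝ) (t : ℝ) : ℝ :=
  ∑' n : ℕ, Real.sin ((3 * ν + 2 * n) * π / 4) * besselMonomial ν n t

theorem besselMonomial_pos {ν : ℝ} (hν : 0 ≤ ν) (n : ℕ) {t : ℝ} (ht : 0 < t) :
    0 < besselMonomial ν n t := by
  have hG : 0 < Real.Gamma (ν + n + 1) := Real.Gamma_pos_of_pos (by positivity)
  unfold besselMonomial
  positivity

theorem besselMonomial_mono {ν : ℝ} (hν : 0 ≤ ν) (n : ℕ) {s t : ℝ} (hs : 0 < s) (hst : s ≤ t) :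
    besselMonomial ν n s ≤ besselMonomial ν n t := by
  have hG : 0 < Real.Gamma (ν + n + 1) := Real.Gamma_pos_of_pos (by positivity)
  unfold besselMonomial
  gcongr

theorem besselMonomial_succ {ν : ℝ} (hν : 0 ≤ ν) (n : ℕ) {t : ℝ} (ht : 0 < t) :
    4 * ((n : ℝ) + 1) * (n + 1 + ν) * besselMonomial ν (n + 1) t =
      t ^ 2 * besselMonomial ν n t := by
  have hG : 0 < Real.Gamma (ν + n + 1) := Real.Gamma_pos_of_pos (by positivity)
  have hpos : 0 < ν + n + 1 := by positivity
  have hGs : Real.Gamma (ν + ((n + 1 : ℕ) : ℝ) + 1) = (ν + n + 1) * Real.Gamma (ν + n + 1) := by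
    rw [← Real.Gamma_add_one hpos.ne']
    push_cast
    ring_nf
  have hpow : (t / 2) ^ (2 * ((n + 1 : ℕ) : ℝ) + ν) =
      (t / 2) ^ (2 * (n : ℝ) + ν) * (t / 2) ^ 2 := by
    rw [← Real.rpow_natCast (t / 2) 2, ← Real.rpow_add (by positivity)]
    push_cast
    ring_nf
  unfold besselMonomial
  rw [hGs, hpow, Nat.factorial_succ]
  push_cast
  field_simp
  ring

theorem hasDerivAt_besselMonomial (ν : ℝ) (n : ℕ) {t : ℝ} (ht : 0 < t) :
    HasDerivAt (besselMonomial ν n) ((2 * n + ν) * besselMonomial ν n t / t) t := by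
  have h := (((hasDerivAt_id t).div_const 2).rpow_const (p := 2 * (n : ℝ) + ν)
    (Or.inl (by simpa using ht.ne'))).div_const (Real.Gamma (ν + n + 1) * n.factorial)
  refine h.congr_deriv ?_
  unfold besselMonomial
  simp only [id]
  rw [Real.rpow_sub_one (by positivity)]
  field_simp

theorem summable_sq_mul_besselMonomial {ν : ℝ} (hν : 0 ≤ ν) {t : ℝ} (ht : 0 < t) :
    Summable fun n : ℕ => (2 * (n : ℝ) + ν + 1) ^ 2 * besselMonomial ν n t := by
  refine summable_of_ratio_norm_eventually_le (r := 1 / 2) (by norm_num) ?_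
  filter_upwards [Filter.eventually_ge_atTop ⌈9 * t ^ 2⌉₊] with n hn
  have hn' : 9 * t ^ 2 ≤ n := Nat.ceil_le.mp hn
  have hM := besselMonomial_pos hν n ht
  have hM' := besselMonomial_pos hν (n + 1) ht
  rw [Real.norm_of_nonneg (by positivity), Real.norm_of_nonneg (by positivity)]
  have hw : (2 * ((n + 1 : ℕ) : ℝ) + ν + 1) ^ 2 ≤ 9 * (2 * (n : ℝ) + ν + 1) ^ 2 := by
    push_cast
    nlinarith [(n.cast_nonneg : (0 : ℝ) ≤ n)]
  have hstep : 18 * besselMonomial ν (n + 1) t ≤ besselMonomial ν n t := by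
    have hn0 : (0 : ℝ) ≤ n := n.cast_nonneg
    have hlow : 36 * t ^ 2 ≤ 4 * ((n : ℝ) + 1) * (n + 1 + ν) := by nlinarith [mul_nonneg hn0 hν]
    have := mul_le_mul_of_nonneg_right hlow hM'.le
    rw [besselMonomial_succ hν n ht] at this
    have ht2 : 0 < t ^ 2 := by positivity
    nlinarith
  calc _ ≤ 9 * (2 * (n : ℝ) + ν + 1) ^ 2 * besselMonomial ν (n + 1) t := by gcongr
    _ = 1 / 2 * ((2 * (n : ℝ) + ν + 1) ^ 2 * (18 * besselMonomial ν (n + 1) t)) := by ring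
    _ ≤ _ := by gcongr

theorem summable_mul_besselMonomial {ν : ℝ} (hν : 0 ≤ ν) {d : ℕ → ℝ}
    (hd : ∀ n : ℕ, |d n| ≤ (2 * n + ν + 1) ^ 2) {t : ℝ} (ht : 0 < t) :
    Summable fun n : ℕ => d n * besselMonomial ν n t := by
  refine (summable_sq_mul_besselMonomial hν ht).of_norm_bounded fun n => ?_
  have hM := besselMonomial_pos hν n ht
  rw [norm_mul, Real.norm_of_nonneg hM.le, Real.norm_eq_abs]
  gcongr
  exact hd n

/-- Termwise differentiation of a series of Bessel monomials. -/
theorem hasDerivAt_tsum_besselMonomial {ν : ℝ} (hν : 0 ≤ ν) {d : ℕ → ℝ}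
    (hd : ∀ n : ℕ, |d n| ≤ 2 * n + ν + 1) {t : ℝ} (ht : 0 < t) :
    HasDerivAt (fun s => ∑' n : ℕ, d n * besselMonomial ν n s)
      ((∑' n : ℕ, d n * (2 * n + ν) * besselMonomial ν n t) / t) t := by
  have htmem : t ∈ Set.Ioo (t / 2) (2 * t) := ⟨by linarith, by linarith⟩
  have hsum := (summable_sq_mul_besselMonomial hν (t := 2 * t) (by positivity)).div_const (t / 2)
  have hd' : ∀ n : ℕ, |d n| ≤ (2 * n + ν + 1) ^ 2 := fun n =>
    (hd n).trans (by nlinarith [(n.cast_nonneg : (0 : ℝ) ≤ n)])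
  have h := hasDerivAt_tsum_of_isPreconnected (𝕜 := ℝ) hsum isOpen_Ioo isPreconnected_Ioo
    (g := fun n s => d n * besselMonomial ν n s)
    (g' := fun n s => d n * ((2 * n + ν) * besselMonomial ν n s / s))
    (fun n s hs => (hasDerivAt_besselMonomial ν n (by linarith [hs.1])).const_mul _)
    (fun n s hs => ?_) htmem (summable_mul_besselMonomial hν hd' ht) htmem
  · refine h.congr_deriv ?_
    rw [← tsum_div_const]
    exact tsum_congr fun n => by ring
  · have hs0 : 0 < s := by linarith [hs.1]
    have hM := besselMonomial_pos hν n hs0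
    have hmono := besselMonomial_mono hν n hs0 hs.2.le
    rw [norm_mul, Real.norm_eq_abs, Real.norm_of_nonneg (by positivity)]
    calc |d n| * ((2 * n + ν) * besselMonomial ν n s / s)
        ≤ (2 * n + ν + 1) * ((2 * n + ν + 1) * besselMonomial ν n (2 * t) / (t / 2)) := by
          have hM' := hM.trans_le hmono
          have hle : (2 * n + ν : ℝ) ≤ 2 * n + ν + 1 := by linarith
          have hs1 := hs.1.le
          have hdn := hd n
          gcongr ?_ * (?_ * ?_ / ?_)
      _ = _ := by ring

/-- The Bessel operator acts termwise on a series of Bessel monomials with bounded coefficients,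
and there it shifts the coefficients. -/
theorem besselOp_tsum_besselMonomial {ν : ℝ} (hν : 0 ≤ ν) {c : ℕ → ℝ} (hc : ∀ n, |c n| ≤ 1)
    {t : ℝ} (ht : 0 < t) :
    besselOp ν (fun s => ∑' n : ℕ, c n * besselMonomial ν n s) t =
      ∑' n : ℕ, c (n + 1) * besselMonomial ν n t := by
  have hc₀ : ∀ n : ℕ, |c n| ≤ 2 * n + ν + 1 := fun n =>
    (hc n).trans (by linarith [(n.cast_nonneg : (0 : ℝ) ≤ n)])
  have hc₁ : ∀ n : ℕ, |c n * (2 * n + ν)| ≤ 2 * n + ν + 1 := fun n => by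
    have hp : (0 : ℝ) ≤ 2 * n + ν := by positivity
    rw [abs_mul, abs_of_nonneg hp]
    nlinarith [hc n]
  have hc₂ : ∀ n : ℕ, |c n * (2 * n + ν) * (2 * n + ν)| ≤ (2 * n + ν + 1) ^ 2 := fun n => by
    have hp : (0 : ℝ) ≤ 2 * n + ν := by positivity
    rw [abs_mul, abs_of_nonneg hp]
    nlinarith [hc₁ n]
  have hderiv : deriv (fun s => ∑' n : ℕ, c n * besselMonomial ν n s) =ᶠ[nhds t]
      fun s => (∑' n : ℕ, c n * (2 * n + ν) * besselMonomial ν n s) / s := by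
    filter_upwards [lt_mem_nhds ht] with s hs
    exact (hasDerivAt_tsum_besselMonomial hν hc₀ hs).deriv
  have hderiv₂ := ((hasDerivAt_tsum_besselMonomial hν hc₁ ht).fun_div (hasDerivAt_id' t)
    ht.ne').deriv
  have hs₀ : Summable fun n : ℕ => c n * besselMonomial ν n t :=
    summable_mul_besselMonomial hν (fun n => (hc₀ n).trans
      (by nlinarith [(n.cast_nonneg : (0 : ℝ) ≤ n)])) ht
  have hs₂ := summable_mul_besselMonomial hν hc₂ ht
  have hdiff := hs₂.sub (hs₀.mul_left (ν ^ 2))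
  have hkey : (∑' n : ℕ, c n * (2 * n + ν) * (2 * n + ν) * besselMonomial ν n t) -
      ν ^ 2 * ∑' n : ℕ, c n * besselMonomial ν n t =
      t ^ 2 * ∑' n : ℕ, c (n + 1) * besselMonomial ν n t := by
    rw [← tsum_mul_left, ← hs₂.tsum_sub (hs₀.mul_left _), hdiff.tsum_eq_zero_add,
      ← tsum_mul_left]
    have hzero : c 0 * (2 * ((0 : ℕ) : ℝ) + ν) * (2 * ((0 : ℕ) : ℝ) + ν) * besselMonomial ν 0 t -
        ν ^ 2 * (c 0 * besselMonomial ν 0 t) = 0 := by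
      push_cast
      ring
    rw [hzero, zero_add]
    refine tsum_congr fun n => ?_
    push_cast
    linear_combination c (n + 1) * besselMonomial_succ hν n ht
  unfold besselOp
  rw [hderiv.deriv_eq, hderiv.eq_of_nhds, hderiv₂,
    ← mul_right_inj' (pow_ne_zero 2 ht.ne'), ← hkey]
  field_simp
  ring

/-- `L_ν Bei_ν = Ber_ν` on `(0,∞)`. -/
theorem besselOp_kelvinBei (ν : ℝ) (hν : 0 ≤ ν) (t : ℝ) (ht : 0 < t) :
    besselOp ν (kelvinBei ν) t = kelvinBer ν t := by
  refine (besselOp_tsum_besselMonomial hν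
    (c := fun n : ℕ => Real.sin ((3 * ν + 2 * n) * π / 4))
    (fun n => Real.abs_sin_le_one _) ht).trans (tsum_congr fun n => ?_)
  rw [← Real.sin_add_pi_div_two]
  push_cast
  ring_nf
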